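/- Fix a slope m ∈ ℝ, and let c* = (A(m) + B'(m))/2. For all c₁, c₂ ∈ ℝ, if |c₁ − c*| ≤ |c₂ − c*| then Max(ℓ_{m,c₁}) ≤ Max(ℓ_{m,c₂}). Consequently, among any set C ⊆ ℝ of allowed intercepts, any intercept closest to c* yields a line of slope m minimizing Max; i.e., the optimal separator of slope m within a constrained family is the one at smallest vertical distance from the unconstrained optimum ℓ_{m,c*}. -/

import Mathlib

open scoped Classical

/-- `MaxErr R B m c` is the maximum Euclidean distance from the line `y = m*x + c`
to a misclassified point (0 if there is none). -/
noncomputable def MaxErr (R B : Finset (ℝ × ℝ)) (m c : ℝ) : ℝ :=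
  max ((R.filter (fun r => m * r.1 + c < r.2)).fold max 0
        (fun r => (r.2 - (m * r.1 + c)) / Real.sqrt (1 + m ^ 2)))
      ((B.filter (fun b => b.2 < m * b.1 + c)).fold max 0
        (fun b => ((m * b.1 + c) - b.2) / Real.sqrt (1 + m ^ 2)))

theorem maxErr_le_iff {R B : Finset (ℝ × ℝ)} {m c d : ℝ} (hd : 0 ≤ d) :
    MaxErr R B m c ≤ d ↔
      (∀ r ∈ R, r.2 - m * r.1 - c ≤ d * √(1 + m ^ 2)) ∧
        ∀ b ∈ B, c - (b.2 - m * b.1) ≤ d * √(1 + m ^ 2) := by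
  have hs : 0 < √(1 + m ^ 2) := by positivity
  have hds : 0 ≤ d * √(1 + m ^ 2) := by positivity
  simp only [MaxErr, max_le_iff, Finset.fold_max_le, Finset.mem_filter, and_imp, div_le_iff₀ hs,
    hd, true_and]
  refine and_congr (forall₂_congr fun r _ => ⟨fun h => ?_, fun h _ => by linarith⟩)
    (forall₂_congr fun b _ => ⟨fun h => ?_, fun h _ => by linarith⟩)
  · by_cases hr : m * r.1 + c < r.2
    · linarith [h hr]
    · linarith
  · by_cases hb : b.2 < m * b.1 + c
    · linarith [h hb]
    · linarith

theorem maxErr_nonneg (R B : Finset (ℝ × ℝ)) (m c : ℝ) : 0 ≤ MaxErr R B m c :=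
  le_max_of_le_left (Finset.le_fold_max 0 |>.2 (Or.inl le_rfl))

/-- The error bound depends on the intercept only through its distance to the midpoint of the
largest red and the smallest blue intercept. -/
theorem maxErr_le_iff_abs_sub_le {R B : Finset (ℝ × ℝ)} (hR : R.Nonempty) (hB : B.Nonempty)
    {m c d : ℝ} (hd : 0 ≤ d) :
    MaxErr R B m c ≤ d ↔
      |c - (R.sup' hR (fun r => r.2 - m * r.1) + B.inf' hB (fun b => b.2 - m * b.1)) / 2| ≤
        d * √(1 + m ^ 2) -
          (R.sup' hR (fun r => r.2 - m * r.1) - B.inf' hB (fun b => b.2 - m * b.1)) / 2 := by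
  have hA : (∀ r ∈ R, r.2 - m * r.1 - c ≤ d * √(1 + m ^ 2)) ↔
      R.sup' hR (fun r => r.2 - m * r.1) ≤ d * √(1 + m ^ 2) + c := by
    simp only [Finset.sup'_le_iff, sub_le_iff_le_add]
  have hB' : (∀ b ∈ B, c - (b.2 - m * b.1) ≤ d * √(1 + m ^ 2)) ↔
      c - d * √(1 + m ^ 2) ≤ B.inf' hB (fun b => b.2 - m * b.1) := by
    simp only [Finset.le_inf'_iff]
    exact forall₂_congr fun b _ => sub_le_comm
  rw [maxErr_le_iff hd, hA, hB', abs_le]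
  constructor <;> rintro ⟨h₁, h₂⟩ <;> constructor <;> linarith

theorem stmt7 (R B : Finset (ℝ × ℝ)) (hR : R.Nonempty) (hB : B.Nonempty) (m : ℝ) :
    let A := R.sup' hR (fun r => r.2 - m * r.1)
    let B' := B.inf' hB (fun b => b.2 - m * b.1)
    let cstar := (A + B') / 2
    (∀ c₁ c₂ : ℝ, |c₁ - cstar| ≤ |c₂ - cstar| → MaxErr R B m c₁ ≤ MaxErr R B m c₂) ∧
    (∀ C : Set ℝ, ∀ c₀ ∈ C, (∀ c ∈ C, |c₀ - cstar| ≤ |c - cstar|) →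
      ∀ c ∈ C, MaxErr R B m c₀ ≤ MaxErr R B m c) := by
  intro A B' cstar
  have hmono : ∀ c₁ c₂ : ℝ, |c₁ - cstar| ≤ |c₂ - cstar| → MaxErr R B m c₁ ≤ MaxErr R B m c₂ :=
    fun c₁ c₂ h => by
      have hd := maxErr_nonneg R B m c₂
      exact (maxErr_le_iff_abs_sub_le hR hB hd).2
        (h.trans ((maxErr_le_iff_abs_sub_le hR hB hd).1 le_rfl))
  exact ⟨hmono, fun _ c₀ _ hmin c hc => hmono c₀ c (hmin c hc)⟩
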